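/- Let Γ^i_{jk} : ℝ^n → ℝ be real-analytic Christoffel symbols, Y_1, …, Y_m : ℝ^n → ℝ^n real-analytic vector fields, and u_1, …, u_m : [0, T] → ℝ continuous controls. Set Y(q, t) = Σ_{a=1}^m Y_a(q) u_a(t), and define vector fields V_k(·, t) recursively by V_1(q, t) = ∫_0^t Y(q, s) ds and V_k(q, t) = −(1/2) Σ_{j=1}^{k−1} ∫_0^t ⟨V_j(q, s) : V_{k−j}(q, s)⟩ ds for k ≥ 2. Let q : [0, T] → ℝ^n be a C² solution of q̈^i + Γ^i_{jk}(q) q̇^j q̇^k = Y^i(q, t) with q(0) = q_0 and q̇(0) = 0. Then there exist T' ∈ (0, T] and a neighborhood U of q_0 such that the series Σ_{k=1}^∞ V_k(q', t) converges absolutely and uniformly for (q', t) ∈ U × [0, T'], and q̇(t) = Σ_{k=1}^∞ V_k(q(t), t) for all t ∈ [0, T']. -/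

import Mathlib

open scoped BigOperators

noncomputable section

/-- `Γ(q)(v,w)` is the vector with `i`-th component `Γ^i_{jk}(q) v^j w^k`. -/
def christoffelOp (n : ℕ) (Γ : (Fin n → ℝ) → Fin n → Fin n → Fin n → ℝ)
    (q v w : Fin n → ℝ) : Fin n → ℝ :=
  fun i => ∑ j, ∑ k, Γ q i j k * v j * w k

/-- The symmetric product `⟨Y_a : Y_b⟩`, with `i`-th component
`(∂Y_a^i/∂q^j) Y_b^j + (∂Y_b^i/∂q^j) Y_a^j + Γ^i_{jk}(Y_a^j Y_b^k + Y_a^k Y_b^j)`. -/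
def symProd (n : ℕ) (Γ : (Fin n → ℝ) → Fin n → Fin n → Fin n → ℝ)
    (Ya Yb : (Fin n → ℝ) → (Fin n → ℝ)) : (Fin n → ℝ) → (Fin n → ℝ) :=
  fun q => fderiv ℝ Ya q (Yb q) + fderiv ℝ Yb q (Ya q)
    + christoffelOp n Γ q (Ya q) (Yb q) + christoffelOp n Γ q (Yb q) (Ya q)

open Set Filter Topology
open scoped ContDiff NNReal ENNReal

section Majorants

variable {E F G : Type*} [NormedAddCommGroup E] [NormedSpace ℝ E]
  [NormedAddCommGroup F] [NormedSpace ℝ F] [NormedAddCommGroup G] [NormedSpace ℝ G]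

/-- Vandermonde's identity for rising factorials. -/
theorem sum_choose_mul_ascFactorial (a b p : ℕ) :
    ∑ ij ∈ Finset.HasAntidiagonal.antidiagonal p,
        p.choose ij.1 * (a.ascFactorial ij.1 * b.ascFactorial ij.2)
      = (a + b).ascFactorial p := by
  induction p with
  | zero => simp
  | succ p ih =>
    have h := Finset.sum_antidiagonal_choose_succ_mul (R := ℕ)
      (fun i j => a.ascFactorial i * b.ascFactorial j) p
    simp only [Nat.cast_id] at h
    rw [h, ← Finset.sum_add_distrib, Nat.ascFactorial_succ, ← ih, Finset.mul_sum]
    refine Finset.sum_congr rfl fun ij hij => ?_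
    have hs : p.choose ij.2 = p.choose ij.1 := by
      rw [← Finset.HasAntidiagonal.mem_antidiagonal.1 hij, add_comm, Nat.choose_symm_add, add_comm]
    rw [Nat.ascFactorial_succ, Nat.ascFactorial_succ, hs,
      ← Finset.HasAntidiagonal.mem_antidiagonal.1 hij]
    ring

/-- The derivatives of `f` at `x` are dominated by those of `c (1 - L z)⁻ᵐ` at `z = 0`. -/
def HasMajorant (f : E → F) (x : E) (L c : ℝ) (m : ℕ) : Prop :=
  ∀ p, ‖iteratedFDeriv ℝ p f x‖ ≤ c * L ^ p * m.ascFactorial p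

namespace HasMajorant

variable {x : E} {L c d : ℝ} {a b m : ℕ}

theorem norm_le {f : E → F} (h : HasMajorant f x L c m) : ‖f x‖ ≤ c := by
  simpa using h 0

theorem nonneg {f : E → F} (h : HasMajorant f x L c m) : 0 ≤ c :=
  (norm_nonneg _).trans h.norm_le

theorem norm_fderiv_le {f : E → F} (h : HasMajorant f x L c m) :
    ‖_root_.fderiv ℝ f x‖ ≤ c * L * m := by
  simpa [← norm_iteratedFDeriv_one, Nat.ascFactorial_succ] using h 1

theorem mono {f : E → F} (h : HasMajorant f x L c m) (hL : 0 ≤ L) (hcd : c ≤ d) :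
    HasMajorant f x L d m := fun p =>
  (h p).trans (by gcongr)

theorem mono_rate {L' : ℝ} {f : E → F} (h : HasMajorant f x L c m) (hL : 0 ≤ L) (hLL' : L ≤ L') :
    HasMajorant f x L' c m := fun p => by
  have := h.nonneg
  exact (h p).trans (by gcongr)

theorem fderiv {f : E → F} (h : HasMajorant f x L c m) :
    HasMajorant (_root_.fderiv ℝ f) x L (c * L * m) (m + 1) := fun p => by
  rw [norm_iteratedFDeriv_fderiv]
  refine (h (p + 1)).trans_eq ?_
  have := Nat.succ_ascFactorial m p
  rw [← Nat.ascFactorial_succ] at this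
  rw [← this]
  push_cast
  ring

theorem add {f g : E → F} (hf : HasMajorant f x L c m) (hg : HasMajorant g x L d m)
    (hf' : ContDiff ℝ ∞ f) (hg' : ContDiff ℝ ∞ g) :
    HasMajorant (fun y => f y + g y) x L (c + d) m := fun p => by
  have h : iteratedFDeriv ℝ p (fun y => f y + g y) x
      = iteratedFDeriv ℝ p f x + iteratedFDeriv ℝ p g x :=
    iteratedFDeriv_add_apply (hf'.contDiffAt.of_le (by exact_mod_cast le_top))
      (hg'.contDiffAt.of_le (by exact_mod_cast le_top))
  rw [h]
  refine (norm_add_le _ _).trans ((add_le_add (hf p) (hg p)).trans_eq (by ring))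

theorem sum {ι : Type*} (s : Finset ι) {f : ι → E → F} {c : ι → ℝ}
    (hf : ∀ i ∈ s, HasMajorant (f i) x L (c i) m) (hf' : ∀ i ∈ s, ContDiff ℝ ∞ (f i)) :
    HasMajorant (fun y => ∑ i ∈ s, f i y) x L (∑ i ∈ s, c i) m := fun p => by
  rw [iteratedFDeriv_fun_sum_apply
    fun i hi => (hf' i hi).contDiffAt.of_le (by exact_mod_cast le_top)]
  rw [Finset.sum_mul, Finset.sum_mul]
  exact norm_sum_le_of_le _ fun i hi => hf i hi p

theorem const_smul {f : E → F} (hf : HasMajorant f x L c m) (hf' : ContDiff ℝ ∞ f) (r : ℝ) :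
    HasMajorant (fun y => r • f y) x L (|r| * c) m := fun p => by
  rw [iteratedFDeriv_const_smul_apply' (hf'.contDiffAt.of_le (by exact_mod_cast le_top)),
    norm_smul, Real.norm_eq_abs, mul_assoc, mul_assoc, ← mul_assoc c]
  gcongr
  exact hf p

theorem neg {f : E → F} (hf : HasMajorant f x L c m) (hf' : ContDiff ℝ ∞ f) :
    HasMajorant (fun y => -f y) x L c m := by
  simpa using hf.const_smul hf' (-1)

theorem clm_apply {f : E → F →L[ℝ] G} {g : E → F} (hf : HasMajorant f x L c a)
    (hg : HasMajorant g x L d b) (hL : 0 ≤ L) (hf' : ContDiff ℝ ∞ f) (hg' : ContDiff ℝ ∞ g) :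
    HasMajorant (fun y => f y (g y)) x L (c * d) (a + b) := fun p => by
  have hc := hf.nonneg
  refine (norm_iteratedFDeriv_clm_apply hf' hg' x (by exact_mod_cast le_top)).trans ?_
  rw [← Finset.Nat.sum_antidiagonal_eq_sum_range_succ
    (fun i j => (p.choose i : ℝ) * ‖iteratedFDeriv ℝ i f x‖ * ‖iteratedFDeriv ℝ j g x‖),
    ← sum_choose_mul_ascFactorial, Nat.cast_sum, Finset.mul_sum]
  refine Finset.sum_le_sum fun ij hij => ?_
  calc (p.choose ij.1 : ℝ) * ‖iteratedFDeriv ℝ ij.1 f x‖ * ‖iteratedFDeriv ℝ ij.2 g x‖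
      ≤ p.choose ij.1 * (c * L ^ ij.1 * a.ascFactorial ij.1)
          * (d * L ^ ij.2 * b.ascFactorial ij.2) := by
        gcongr
        exacts [hf _, hg _]
    _ = _ := by
        rw [← Finset.HasAntidiagonal.mem_antidiagonal.1 hij]
        push_cast
        ring

end HasMajorant

/-- Cauchy estimates for the derivatives of an analytic function near a point. -/
theorem AnalyticAt.exists_hasMajorant [CompleteSpace F] {f : E → F} {x₀ : E}
    (hf : AnalyticAt ℝ f x₀) :
    ∃ C L : ℝ, 0 ≤ L ∧ ∀ᶠ x in 𝓝 x₀, HasMajorant f x L C 1 := by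
  obtain ⟨P, R, hP⟩ := hf
  obtain ⟨r, hr0, hr⟩ : ∃ r : ℝ≥0, 0 < r ∧ (r + r : ℝ≥0∞) < R := by
    obtain ⟨s, hs0, hs⟩ := ENNReal.lt_iff_exists_nnreal_btwn.1 hP.r_pos
    refine ⟨s / 2, by have := ENNReal.coe_pos.1 hs0; positivity, ?_⟩
    rwa [← ENNReal.coe_add, add_halves]
  have hS := P.changeOriginSeries_summable_aux₁ (hr.trans_le hP.r_le)
  set S := ∑' s : Σ k l : ℕ, { s : Finset (Fin (k + l)) // s.card = l },
    ‖P (s.1 + s.2.1)‖₊ * r ^ s.2.1 * r ^ s.1 with hSdef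
  refine ⟨S, (r : ℝ)⁻¹, by positivity, ?_⟩
  filter_upwards [Metric.ball_mem_nhds x₀ (NNReal.coe_pos.2 hr0)] with x hx p
  obtain ⟨y, rfl⟩ : ∃ y, x₀ + y = x := ⟨x - x₀, by simp⟩
  have hy : ‖y‖₊ ≤ r := by
    rw [← NNReal.coe_le_coe]
    simpa using (mem_ball_iff_norm.1 hx).le
  have hrR : (r : ℝ≥0∞) < R := lt_of_le_of_lt (by simp) hr
  have hyR : (‖y‖₊ : ℝ≥0∞) < R := lt_of_le_of_lt (by exact_mod_cast hy) hrR
  have hbound : ‖P.changeOrigin y p‖₊ * r ^ p ≤ S := by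
    have h1 := P.nnnorm_changeOrigin_le p (hyR.trans_le hP.r_le)
    have h2 := P.changeOriginSeries_summable_aux₂ (hrR.trans_le hP.r_le) p
    have h3 : ‖P.changeOrigin y p‖₊ ≤
        ∑' s : Σ l : ℕ, { s : Finset (Fin (p + l)) // s.card = l },
          ‖P (p + s.1)‖₊ * r ^ s.1 :=
      h1.trans ((P.changeOriginSeries_summable_aux₂ (hyR.trans_le hP.r_le) p).tsum_le_tsum
        (fun s => by gcongr) h2)
    calc ‖P.changeOrigin y p‖₊ * r ^ p
        ≤ (∑' s : Σ l : ℕ, { s : Finset (Fin (p + l)) // s.card = l },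
          ‖P (p + s.1)‖₊ * r ^ s.1) * r ^ p := by gcongr
      _ = ∑' s : Σ l : ℕ, { s : Finset (Fin (p + l)) // s.card = l },
          ‖P (p + s.1)‖₊ * r ^ s.1 * r ^ p := by rw [NNReal.tsum_mul_right]
      _ ≤ S := by
        have h4 := NNReal.summable_sigma.1 hS
        rw [hSdef, hS.tsum_sigma' h4.1]
        exact h4.2.le_tsum p fun _ _ => zero_le
  have hcoef : ‖P.changeOrigin y p‖ ≤ S * (r : ℝ)⁻¹ ^ p := by
    rw [inv_pow, ← div_eq_mul_inv, le_div_iff₀ (by positivity)]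
    exact_mod_cast hbound
  refine ContinuousMultilinearMap.opNorm_le_bound (by positivity) fun v => ?_
  rw [(hP.changeOrigin hyR).iteratedFDeriv_eq_sum_of_completeSpace]
  calc ‖∑ σ : Equiv.Perm (Fin p), P.changeOrigin y p fun i => v (σ i)‖
      ≤ ∑ _σ : Equiv.Perm (Fin p), (S : ℝ) * (r : ℝ)⁻¹ ^ p * ∏ i, ‖v i‖ := by
        refine norm_sum_le_of_le _ fun σ _ => ?_
        refine ((P.changeOrigin y p).le_opNorm _).trans ?_
        rw [Equiv.prod_comp σ fun i => ‖v i‖]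
        gcongr
    _ = _ := by
        simp only [Finset.sum_const, Finset.card_univ, Fintype.card_perm, Fintype.card_fin,
          nsmul_eq_mul, Nat.one_ascFactorial]
        ring

end Majorants

section Separated

variable {E F : Type*} [NormedAddCommGroup E] [NormedSpace ℝ E]
  [NormedAddCommGroup F] [NormedSpace ℝ F]

theorem iteratedFDeriv_sum_const_smul {ι : Type*} [Fintype ι] (c : ι → ℝ) {h : ι → E → F}
    (hh : ∀ i, ContDiff ℝ ∞ (h i)) (p : ℕ) (x : E) :
    iteratedFDeriv ℝ p (fun x => ∑ i, c i • h i x) x = ∑ i, c i • iteratedFDeriv ℝ p (h i) x := by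
  have hd : ∀ i, ContDiff ℝ p (h i) := fun i => (hh i).of_le (by exact_mod_cast le_top)
  have hs : ∀ i ∈ Finset.univ, ContDiffAt ℝ p (fun x => c i • h i x) x := fun i _ =>
    contDiffAt_const.smul (hd i).contDiffAt
  rw [iteratedFDeriv_fun_sum_apply hs]
  exact Finset.sum_congr rfl fun i _ => iteratedFDeriv_const_smul_apply' (hd i).contDiffAt

theorem fderiv_sum_const_smul {ι : Type*} [Fintype ι] (c : ι → ℝ) {h : ι → E → F}
    (hh : ∀ i, ContDiff ℝ ∞ (h i)) (x : E) :
    fderiv ℝ (fun x => ∑ i, c i • h i x) x = ∑ i, c i • fderiv ℝ (h i) x := by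
  have hd : ∀ i, DifferentiableAt ℝ (h i) x := fun i => (hh i).differentiable (by simp) x
  exact (HasFDerivAt.fun_sum fun i _ => (hd i).hasFDerivAt.const_smul (c i)).fderiv

/-- `f` is, on `[0, T]`, a finite sum of products of a continuous function of time and a smooth
function of space. -/
def IsSeparated (T : ℝ) (f : ℝ → E → F) : Prop :=
  ∃ (ι : Type) (_ : Fintype ι) (φ : ι → ℝ → ℝ) (h : ι → E → F),
    (∀ i, Continuous (φ i)) ∧ (∀ i, ContDiff ℝ ∞ (h i)) ∧
      ∀ t ∈ Icc 0 T, ∀ x, f t x = ∑ i, φ i t • h i x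

namespace IsSeparated

variable {T t : ℝ} {f g : ℝ → E → F}

theorem congr (hf : IsSeparated T f) (hfg : ∀ t ∈ Icc 0 T, ∀ x, g t x = f t x) :
    IsSeparated T g := by
  obtain ⟨ι, _, φ, h, hφ, hh, H⟩ := hf
  exact ⟨ι, _, φ, h, hφ, hh, fun t ht x => (hfg t ht x).trans (H t ht x)⟩

theorem smul_of_continuousOn {u : ℝ → ℝ} {h : E → F} (hT : 0 ≤ T) (hu : ContinuousOn u (Icc 0 T))
    (hh : ContDiff ℝ ∞ h) : IsSeparated T fun t x => u t • h x := by
  refine ⟨Unit, inferInstance, fun _ => IccExtend hT ((Icc 0 T).domRestrict u), fun _ => h,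
    fun _ => (continuousOn_iff_continuous_domRestrict.1 hu).Icc_extend', fun _ => hh,
    fun t ht x => ?_⟩
  simp [IccExtend_of_mem hT _ ht, Set.domRestrict]

theorem zero : IsSeparated T fun (_ : ℝ) (_ : E) => (0 : F) :=
  ⟨Empty, inferInstance, fun _ _ => 0, fun _ (_ : E) => 0, fun _ => continuous_const,
    fun _ => contDiff_const, by simp⟩

theorem add (hf : IsSeparated T f) (hg : IsSeparated T g) :
    IsSeparated T fun t x => f t x + g t x := by
  obtain ⟨ι, _, φ, h, hφ, hh, H⟩ := hf
  obtain ⟨κ, _, ψ, k, hψ, hk, K⟩ := hg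
  refine ⟨ι ⊕ κ, inferInstance, Sum.elim φ ψ, Sum.elim h k, ?_, ?_, fun t ht x => ?_⟩
  · rintro (i | i) <;> simp [hφ, hψ]
  · rintro (i | i) <;> simp [hh, hk]
  · simp [H t ht, K t ht]

theorem sum {κ : Type*} (s : Finset κ) {f : κ → ℝ → E → F} (hf : ∀ i ∈ s, IsSeparated T (f i)) :
    IsSeparated T fun t x => ∑ i ∈ s, f i t x := by
  classical
  induction s using Finset.induction_on with
  | empty => simpa using zero
  | insert a s ha ih =>
    simp only [Finset.sum_insert ha]
    exact (hf a (by simp)).add (ih fun i hi => hf i (by simp [hi]))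

theorem const_smul (hf : IsSeparated T f) (r : ℝ) : IsSeparated T fun t x => r • f t x := by
  obtain ⟨ι, _, φ, h, hφ, hh, H⟩ := hf
  refine ⟨ι, inferInstance, fun i t => r * φ i t, h, fun i => (hφ i).const_mul r, hh,
    fun t ht x => ?_⟩
  simp [H t ht, Finset.smul_sum, smul_smul]

theorem neg (hf : IsSeparated T f) : IsSeparated T fun t x => -f t x := by
  simpa using hf.const_smul (-1)

theorem contDiff (hf : IsSeparated T f) (ht : t ∈ Icc 0 T) : ContDiff ℝ ∞ (f t) := by
  obtain ⟨ι, _, φ, h, hφ, hh, H⟩ := hf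
  rw [funext (H t ht)]
  exact ContDiff.sum fun i _ => contDiff_const.smul (hh i)

theorem clm_apply {f : ℝ → E → E →L[ℝ] F} {g : ℝ → E → E} (hf : IsSeparated T f)
    (hg : IsSeparated T g) : IsSeparated T fun t x => f t x (g t x) := by
  obtain ⟨ι, _, φ, h, hφ, hh, H⟩ := hf
  obtain ⟨κ, _, ψ, k, hψ, hk, K⟩ := hg
  refine ⟨ι × κ, inferInstance, fun i t => φ i.1 t * ψ i.2 t, fun i x => h i.1 x (k i.2 x),
    fun i => (hφ _).mul (hψ _), fun i => (hh _).clm_apply (hk _), fun t ht x => ?_⟩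
  simp only [H t ht, K t ht, map_sum, map_smul, sum_apply, smul_apply,
    Fintype.sum_prod_type, Finset.smul_sum, smul_smul]
  rw [Finset.sum_comm]
  simp only [mul_comm]

theorem clm_comp {f : ℝ → E → E} (hf : IsSeparated T f) {A : E → E →L[ℝ] F}
    (hA : ContDiff ℝ ∞ A) : IsSeparated T fun t x => A x (f t x) := by
  obtain ⟨ι, _, φ, h, hφ, hh, H⟩ := hf
  refine ⟨ι, inferInstance, φ, fun i x => A x (h i x), hφ, fun i => hA.clm_apply (hh i),
    fun t ht x => ?_⟩
  simp [H t ht]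

theorem fderiv (hf : IsSeparated T f) : IsSeparated T fun t x => _root_.fderiv ℝ (f t) x := by
  obtain ⟨ι, _, φ, h, hφ, hh, H⟩ := hf
  refine ⟨ι, inferInstance, φ, fun i => _root_.fderiv ℝ (h i), hφ,
    fun i => (hh i).fderiv_right (by simp), fun t ht x => ?_⟩
  beta_reduce
  rw [funext (H t ht), fderiv_sum_const_smul _ hh]

theorem continuousOn (hf : IsSeparated T f) (x : E) : ContinuousOn (fun t => f t x) (Icc 0 T) := by
  obtain ⟨ι, _, φ, h, hφ, hh, H⟩ := hf
  refine ContinuousOn.congr ?_ fun t ht => H t ht x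
  exact (continuous_finsetSum _ fun i _ => (hφ i).smul continuous_const).continuousOn

theorem intervalIntegrable (hf : IsSeparated T f) (ht : t ∈ Icc 0 T) (x : E) :
    IntervalIntegrable (fun s => f s x) MeasureTheory.volume 0 t :=
  ((hf.continuousOn x).mono (Icc_subset_Icc_right ht.2)).intervalIntegrable_of_Icc ht.1

variable [CompleteSpace F]

theorem integral_eq_sum {X : Type*} {f : ℝ → X → F} {ι : Type} [Fintype ι] {φ : ι → ℝ → ℝ}
    {h : ι → X → F} (hφ : ∀ i, Continuous (φ i))
    (H : ∀ t ∈ Icc 0 T, ∀ x, f t x = ∑ i, φ i t • h i x)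
    (ht : t ∈ Icc 0 T) (x : X) :
    ∫ s in (0 : ℝ)..t, f s x = ∑ i, (∫ s in (0 : ℝ)..t, φ i s) • h i x := by
  have h1 : ∫ s in (0 : ℝ)..t, f s x = ∫ s in (0 : ℝ)..t, ∑ i, φ i s • h i x := by
    refine intervalIntegral.integral_congr fun s hs => ?_
    rw [uIcc_of_le ht.1] at hs
    exact H s ⟨hs.1, hs.2.trans ht.2⟩ x
  have h2 : ∀ i ∈ Finset.univ, IntervalIntegrable (fun s => φ i s • h i x)
      MeasureTheory.volume 0 t := fun i _ =>
    ((hφ i).smul continuous_const).intervalIntegrable _ _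
  rw [h1, intervalIntegral.integral_finsetSum h2]
  simp

theorem integral (hf : IsSeparated T f) : IsSeparated T fun t x => ∫ s in (0 : ℝ)..t, f s x := by
  obtain ⟨ι, _, φ, h, hφ, hh, H⟩ := hf
  exact ⟨ι, inferInstance, fun i t => ∫ s in (0 : ℝ)..t, φ i s, h,
    fun i => intervalIntegral.continuous_primitive (fun a b => (hφ i).intervalIntegrable a b) 0,
    hh, fun t ht x => integral_eq_sum hφ H ht x⟩

theorem iteratedFDeriv_integral (hf : IsSeparated T f) (ht : t ∈ Icc 0 T) (p : ℕ) (x : E) :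
    iteratedFDeriv ℝ p (fun x => ∫ s in (0 : ℝ)..t, f s x) x
      = ∫ s in (0 : ℝ)..t, iteratedFDeriv ℝ p (f s) x := by
  obtain ⟨ι, _, φ, h, hφ, hh, H⟩ := hf
  rw [funext (integral_eq_sum hφ H ht), iteratedFDeriv_sum_const_smul _ hh]
  refine (integral_eq_sum (f := fun s x => iteratedFDeriv ℝ p (f s) x) hφ
    (fun t ht x => ?_) ht x).symm
  rw [funext (H t ht), iteratedFDeriv_sum_const_smul _ hh]

theorem hasMajorant_integral (hf : IsSeparated T f) (ht : t ∈ Icc 0 T) {x : E} {L b : ℝ} {m r : ℕ}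
    (hb : ∀ s ∈ Icc 0 t, HasMajorant (f s) x L (b * s ^ r) m) :
    HasMajorant (fun x => ∫ s in (0 : ℝ)..t, f s x) x L (b * (t ^ (r + 1) / (r + 1))) m := by
  intro p
  rw [hf.iteratedFDeriv_integral ht]
  have hint : IntervalIntegrable (fun s : ℝ => b * s ^ r * L ^ p * m.ascFactorial p)
      MeasureTheory.volume 0 t := by
    apply Continuous.intervalIntegrable
    fun_prop
  refine (intervalIntegral.norm_integral_le_of_norm_le ht.1
    (MeasureTheory.ae_of_all _ fun s hs => hb s ⟨hs.1.le, hs.2⟩ p) hint).trans_eq ?_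
  simp [intervalIntegral.integral_mul_const, intervalIntegral.integral_const_mul, integral_pow]

theorem hasDerivWithinAt_integral_comp (hf : IsSeparated T f) {q : ℝ → E} {v : E}
    (ht : t ∈ Icc 0 T) (hq : HasDerivWithinAt q v (Icc 0 T) t) :
    HasDerivWithinAt (fun τ => ∫ s in (0 : ℝ)..τ, f s (q τ))
      (f t (q t) + _root_.fderiv ℝ (fun x => ∫ s in (0 : ℝ)..t, f s x) (q t) v) (Icc 0 T) t := by
  obtain ⟨ι, _, φ, h, hφ, hh, H⟩ := hf
  have hd : ∀ i x, DifferentiableAt ℝ (h i) x := fun i x => (hh i).differentiable (by simp) x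
  have hder : HasDerivWithinAt (fun τ => ∑ i, (∫ s in (0 : ℝ)..τ, φ i s) • h i (q τ))
      (∑ i, ((∫ s in (0 : ℝ)..t, φ i s) • _root_.fderiv ℝ (h i) (q t) v
        + φ i t • h i (q t))) (Icc 0 T) t := by
    refine HasDerivWithinAt.fun_sum fun i _ => ?_
    refine HasDerivWithinAt.fun_smul ?_ ?_
    · exact (intervalIntegral.integral_hasDerivAt_right ((hφ i).intervalIntegrable _ _)
        (hφ i).stronglyMeasurable.stronglyMeasurableAtFilter
        (hφ i).continuousAt).hasDerivWithinAt
    · exact (hd i (q t)).hasFDerivAt.comp_hasDerivWithinAt t hq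
  refine (hder.congr_of_mem (fun τ hτ => integral_eq_sum hφ H hτ (q τ)) ht).congr_deriv ?_
  rw [funext (integral_eq_sum hφ H ht), fderiv_sum_const_smul _ hh, H t ht,
    Finset.sum_add_distrib, add_comm]
  simp

end IsSeparated

end Separated

section Recursion

variable {E : Type*} [NormedAddCommGroup E] [NormedSpace ℝ E]

/-- The covariant derivative of `X` along `Z` for the connection with Christoffel form `G`. -/
def covDeriv (G : E → E →L[ℝ] E →L[ℝ] E) (X Z : E → E) : E → E :=
  fun x => fderiv ℝ X x (Z x) + G x (X x) (Z x)

/-- The time derivatives of the terms `W k` of the velocity series. -/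
def velocityRate (G : E → E →L[ℝ] E →L[ℝ] E) (Y : ℝ → E → E) (W : ℕ → ℝ → E → E) :
    ℕ → ℝ → E → E
  | 0 => Y
  | k + 1 => fun t x =>
      -∑ ij ∈ Finset.HasAntidiagonal.antidiagonal k, covDeriv G (W ij.1 t) (W ij.2 t) x

variable {G : E → E →L[ℝ] E →L[ℝ] E} {Y : ℝ → E → E} {W : ℕ → ℝ → E → E} {T : ℝ}

theorem IsSeparated.covDeriv {X Z : ℝ → E → E} (hX : IsSeparated T X) (hZ : IsSeparated T Z)
    (hG : ContDiff ℝ ∞ G) : IsSeparated T fun t => _root_.covDeriv G (X t) (Z t) :=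
  (hX.fderiv.clm_apply hZ).add ((hX.clm_comp hG).clm_apply hZ)

theorem isSeparated_velocityRate (hG : ContDiff ℝ ∞ G) (hY : IsSeparated T Y)
    (hW : ∀ k, IsSeparated T (W k)) (k : ℕ) : IsSeparated T (velocityRate G Y W k) := by
  cases k with
  | zero => exact hY
  | succ k => exact (IsSeparated.sum _ fun ij _ => (hW ij.1).covDeriv (hW ij.2) hG).neg

theorem HasMajorant.covDeriv {X Z : E → E} {x : E} {L C c d : ℝ} {a b : ℕ}
    (hX : HasMajorant X x L c a) (hZ : HasMajorant Z x L d b) (hG : HasMajorant G x L C 1)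
    (hL : 0 ≤ L) (hX' : ContDiff ℝ ∞ X) (hZ' : ContDiff ℝ ∞ Z) (hG' : ContDiff ℝ ∞ G) :
    HasMajorant (_root_.covDeriv G X Z) x L ((L * a + C) * (c * d)) (a + b + 1) := by
  have hX1 : ContDiff ℝ ∞ (_root_.fderiv ℝ X) := hX'.fderiv_right (by simp)
  have h1 := hX.fderiv.clm_apply hZ hL hX1 hZ'
  have h2 := (hG.clm_apply hX hL hG' hX').clm_apply hZ hL (hG'.clm_apply hX') hZ'
  rw [show a + 1 + b = a + b + 1 by ring] at h1
  rw [show 1 + a + b = a + b + 1 by ring] at h2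
  refine (h1.add h2 (hX1.clm_apply hZ') ((hG'.clm_apply hX').clm_apply hZ')).mono hL (le_of_eq ?_)
  ring

/-- The `k`-th term of the velocity series has a majorant growing like a Catalan number. -/
theorem hasMajorant_velocity_term [CompleteSpace E] (hG : ContDiff ℝ ∞ G)
    (hY : IsSeparated T Y) (hW : ∀ k, IsSeparated T (W k))
    (hrec : ∀ k, ∀ t ∈ Icc 0 T, ∀ x, W k t x = ∫ s in (0 : ℝ)..t, velocityRate G Y W k s x)
    {x : E} {L C c : ℝ} (hL : 0 ≤ L) (hGx : HasMajorant G x L C 1)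
    (hYx : ∀ t ∈ Icc 0 T, HasMajorant (Y t) x L c 1) (k : ℕ) :
    ∀ t ∈ Icc 0 T, HasMajorant (W k t) x L
      (c ^ (k + 1) * (L + C) ^ k * catalan k * t ^ (2 * k + 1)) (2 * k + 1) := by
  induction k using Nat.strong_induction_on with
  | _ k ih =>
  intro t ht
  have hc : 0 ≤ c := (hYx t ht).nonneg
  have hC : 0 ≤ C := hGx.nonneg
  have hrate := isSeparated_velocityRate hG hY hW k
  rw [funext (hrec k t ht)]
  cases k with
  | zero =>
    refine (hrate.hasMajorant_integral ht (b := c) (r := 0) fun s hs => ?_).mono hL ?_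
    · simpa using! hYx s ⟨hs.1, hs.2.trans ht.2⟩
    · simp
  | succ k =>
    have ht0 := ht.1
    refine (hrate.hasMajorant_integral ht
      (b := (2 * k + 3) * (c ^ (k + 2) * (L + C) ^ (k + 1) * catalan (k + 1))) (r := 2 * k + 2)
      fun s hs => ?_).mono hL (le_of_eq ?_)
    · have hsT : s ∈ Icc 0 T := ⟨hs.1, hs.2.trans ht.2⟩
      have hs0 := hs.1
      have hsm : ∀ ij ∈ Finset.HasAntidiagonal.antidiagonal k,
          ContDiff ℝ ∞ (covDeriv G (W ij.1 s) (W ij.2 s)) := fun ij _ =>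
        ((hW ij.1).covDeriv (hW ij.2) hG).contDiff hsT
      refine (HasMajorant.sum _ (c := fun ij => (2 * k + 3) * (c ^ (k + 2) * (L + C) ^ (k + 1)
        * (catalan ij.1 * catalan ij.2)) * s ^ (2 * k + 2)) (fun ij hij => ?_) hsm).neg
          (ContDiff.sum hsm) |>.mono hL (le_of_eq ?_)
      · have hk := Finset.HasAntidiagonal.mem_antidiagonal.1 hij
        have h := (ih ij.1 (by omega) s hsT).covDeriv (ih ij.2 (by omega) s hsT) hGx hL
          ((hW ij.1).contDiff hsT) ((hW ij.2).contDiff hsT) hG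
        rw [show 2 * ij.1 + 1 + (2 * ij.2 + 1) + 1 = 2 * (k + 1) + 1 by omega] at h
        refine h.mono hL ?_
        have hi : (ij.1 : ℝ) ≤ k := by exact_mod_cast (by omega : ij.1 ≤ k)
        calc (L * ((2 * ij.1 + 1 : ℕ) : ℝ) + C)
              * (c ^ (ij.1 + 1) * (L + C) ^ ij.1 * catalan ij.1 * s ^ (2 * ij.1 + 1)
                * (c ^ (ij.2 + 1) * (L + C) ^ ij.2 * catalan ij.2 * s ^ (2 * ij.2 + 1)))
            = (L * (2 * ij.1 + 1) + C) * (c ^ (k + 2) * (L + C) ^ k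
                * (catalan ij.1 * catalan ij.2) * s ^ (2 * k + 2)) := by
              rw [← hk]
              push_cast
              ring
          _ ≤ ((2 * k + 3) * (L + C)) * (c ^ (k + 2) * (L + C) ^ k
                * (catalan ij.1 * catalan ij.2) * s ^ (2 * k + 2)) := by
              gcongr
              nlinarith
          _ = _ := by ring
      · rw [catalan_succ', ← Finset.sum_mul, ← Finset.mul_sum, ← Finset.mul_sum]
        push_cast
        ring
    · push_cast
      field_simp
      ring

theorem catalan_le_four_pow (k : ℕ) : catalan k ≤ 4 ^ k := by
  rw [catalan_eq_centralBinom_div]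
  refine (Nat.div_le_self _ _).trans ?_
  calc k.centralBinom ≤ 2 ^ (2 * k) := Nat.choose_le_two_pow _ _
    _ = 4 ^ k := by rw [pow_mul]; norm_num

theorem two_mul_add_one_mul_quarter_pow_le (k : ℕ) :
    (2 * k + 1 : ℝ) * (1 / 4) ^ k ≤ 2 * (1 / 2) ^ k := by
  have h : (2 * k + 1 : ℝ) ≤ 2 * 2 ^ k := by
    have : (k : ℝ) + 1 ≤ 2 ^ k := by exact_mod_cast Nat.lt_two_pow_self
    linarith
  calc (2 * k + 1 : ℝ) * (1 / 4) ^ k ≤ 2 * 2 ^ k * (1 / 4) ^ k := by gcongr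
    _ = 2 * (1 / 2) ^ k := by rw [mul_assoc, ← mul_pow]; norm_num

/-- On a short time interval the velocity series and its space derivative are dominated by a
geometric series. -/
theorem exists_time_geometric_bound [CompleteSpace E] (hT : 0 < T) (hG : ContDiff ℝ ∞ G)
    (hY : IsSeparated T Y) (hW : ∀ k, IsSeparated T (W k))
    (hrec : ∀ k, ∀ t ∈ Icc 0 T, ∀ x, W k t x = ∫ s in (0 : ℝ)..t, velocityRate G Y W k s x)
    {L C c : ℝ} (hL : 0 ≤ L) (hC : 0 ≤ C) (hc : 0 ≤ c) :
    ∃ T₁ ∈ Ioc 0 T, ∃ A, 0 ≤ A ∧ ∀ x, HasMajorant G x L C 1 →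
      (∀ t ∈ Icc 0 T, HasMajorant (Y t) x L c 1) → ∀ k, ∀ t ∈ Icc 0 T₁,
        ‖W k t x‖ ≤ A * (1 / 2) ^ k ∧ ‖fderiv ℝ (W k t) x‖ ≤ A * (1 / 2) ^ k := by
  have hden : 0 < 1 + 16 * (c * (L + C)) := by positivity
  refine ⟨min (min 1 T) (1 / (1 + 16 * (c * (L + C)))), ⟨by positivity,
    (min_le_left _ _).trans (min_le_right _ _)⟩, c + 2 * (c * L), by positivity,
    fun x hGx hYx k t ht => ?_⟩
  have ht0 := ht.1
  have ht1 : t ≤ 1 := ht.2.trans ((min_le_left _ _).trans (min_le_left _ _))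
  have htT : t ≤ T := ht.2.trans ((min_le_left _ _).trans (min_le_right _ _))
  have ht2 : t * (1 + 16 * (c * (L + C))) ≤ 1 :=
    (le_div_iff₀ hden).1 (ht.2.trans (min_le_right _ _))
  have hmaj := hasMajorant_velocity_term hG hY hW hrec hL hGx hYx k t ⟨ht0, htT⟩
  have hratio : c * (L + C) * 4 * t ^ 2 ≤ 1 / 4 := by
    have h1 : c * (L + C) * t ^ 2 ≤ c * (L + C) * t := by
      have : t ^ 2 ≤ t := by nlinarith
      gcongr
    linarith
  have hcoef : c ^ (k + 1) * (L + C) ^ k * catalan k * t ^ (2 * k + 1) ≤ c * (1 / 4) ^ k := by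
    calc c ^ (k + 1) * (L + C) ^ k * catalan k * t ^ (2 * k + 1)
        ≤ c ^ (k + 1) * (L + C) ^ k * 4 ^ k * (t ^ (2 * k) * 1) := by
          rw [pow_succ t]
          gcongr
          exact_mod_cast catalan_le_four_pow k
      _ = c * (c * (L + C) * 4 * t ^ 2) ^ k := by
          rw [pow_mul, mul_pow, mul_pow, mul_pow]
          ring
      _ ≤ c * (1 / 4) ^ k := by gcongr
  have hquarter : (1 / 4 : ℝ) ^ k ≤ (1 / 2) ^ k := by gcongr; norm_num
  constructor
  · calc ‖W k t x‖ ≤ c * (1 / 4) ^ k := hmaj.norm_le.trans hcoef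
      _ ≤ c * (1 / 2) ^ k := by gcongr
      _ ≤ (c + 2 * (c * L)) * (1 / 2) ^ k := by
        gcongr
        linarith [mul_nonneg hc hL]
  · calc ‖fderiv ℝ (W k t) x‖ ≤ c * (1 / 4) ^ k * L * (2 * k + 1 : ℕ) :=
          hmaj.norm_fderiv_le.trans (by gcongr)
      _ = c * L * ((2 * k + 1) * (1 / 4) ^ k) := by push_cast; ring
      _ ≤ c * L * (2 * (1 / 2) ^ k) := by
        have := two_mul_add_one_mul_quarter_pow_le k
        gcongr
      _ ≤ (c + 2 * (c * L)) * (1 / 2) ^ k := by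
        have : 0 ≤ c * (1 / 2 : ℝ) ^ k := by positivity
        linarith

end Recursion

/-- The sum of a geometrically bounded family over a square and over the triangle below its
diagonal differ by a small remainder. -/
theorem norm_sum_square_sub_sum_triangle_le {E : Type*} [NormedAddCommGroup E]
    {P : ℕ → ℕ → E} {B : ℝ}
    (hP : ∀ i j, ‖P i j‖ ≤ B * (1 / 2) ^ (i + j)) (n : ℕ) :
    ‖∑ i ∈ Finset.range (n + 1), ∑ j ∈ Finset.range (n + 1), P i j
      - ∑ k ∈ Finset.range n, ∑ ij ∈ Finset.HasAntidiagonal.antidiagonal k, P ij.1 ij.2‖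
      ≤ (n + 1 : ℝ) ^ 2 * (B * (1 / 2) ^ n) := by
  have hB : 0 ≤ B := by simpa using (norm_nonneg _).trans (hP 0 0)
  set s := Finset.range (n + 1) ×ˢ Finset.range (n + 1) with hs
  have htri : ∑ k ∈ Finset.range n, ∑ ij ∈ Finset.HasAntidiagonal.antidiagonal k, P ij.1 ij.2
      = ∑ ij ∈ s with ij.1 + ij.2 < n, P ij.1 ij.2 := by
    rw [← Finset.sum_fiberwise_of_maps_to (t := Finset.range n) (g := fun ij : ℕ × ℕ => ij.1 + ij.2)
      (fun ij hij => by simpa using (Finset.mem_filter.1 hij).2)]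
    refine Finset.sum_congr rfl fun k hk => Finset.sum_congr ?_ fun _ _ => rfl
    ext ij
    simp only [hs, Finset.HasAntidiagonal.mem_antidiagonal, Finset.mem_filter, Finset.mem_product,
      Finset.mem_range] at hk ⊢
    omega
  rw [← Finset.sum_product', ← hs, htri,
    ← Finset.sum_filter_add_sum_filter_not s (fun ij => ij.1 + ij.2 < n), add_sub_cancel_left]
  calc ‖∑ ij ∈ s with ¬ij.1 + ij.2 < n, P ij.1 ij.2‖
      ≤ ∑ ij ∈ s with ¬ij.1 + ij.2 < n, B * (1 / 2) ^ n := by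
        refine norm_sum_le_of_le _ fun ij hij => (hP _ _).trans ?_
        have := (Finset.mem_filter.1 hij).2
        gcongr ?_ * ?_
        exact pow_le_pow_of_le_one (by norm_num) (by norm_num) (by omega)
    _ ≤ ∑ ij ∈ s, B * (1 / 2) ^ n :=
        Finset.sum_le_sum_of_subset_of_nonneg (Finset.filter_subset _ _)
          fun _ _ _ => by positivity
    _ = (n + 1 : ℝ) ^ 2 * (B * (1 / 2) ^ n) := by
        rw [Finset.sum_const, hs, Finset.card_product, Finset.card_range, nsmul_eq_mul]
        push_cast
        ring

section Velocity

variable {E : Type*} [NormedAddCommGroup E] [NormedSpace ℝ E] [CompleteSpace E]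
  {G : E → E →L[ℝ] E →L[ℝ] E} {Y : ℝ → E → E} {W : ℕ → ℝ → E → E} {T : ℝ}

/-- If the terms of the velocity series and their space derivatives are geometrically small along a
solution starting from rest, then the series sums to the velocity of the solution. -/
theorem hasSum_velocity (hG : ContDiff ℝ ∞ G) (hY : IsSeparated T Y)
    (hW : ∀ k, IsSeparated T (W k))
    (hrec : ∀ k, ∀ t ∈ Icc 0 T, ∀ x, W k t x = ∫ s in (0 : ℝ)..t, velocityRate G Y W k s x)
    {q v : ℝ → E} (hq : ∀ t ∈ Icc 0 T, HasDerivWithinAt q (v t) (Icc 0 T) t)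
    (hv : ∀ t ∈ Icc 0 T,
      HasDerivWithinAt v (Y t (q t) - G (q t) (v t) (v t)) (Icc 0 T) t)
    (hv0 : v 0 = 0) {T₁ : ℝ} (hT₁ : T₁ ∈ Ioc 0 T) {A C : ℝ}
    (hGq : ∀ t ∈ Icc 0 T₁, ‖G (q t)‖ ≤ C)
    (hWq : ∀ k, ∀ t ∈ Icc 0 T₁, ‖W k t (q t)‖ ≤ A * (1 / 2) ^ k)
    (hDq : ∀ k, ∀ t ∈ Icc 0 T₁, ‖fderiv ℝ (W k t) (q t)‖ ≤ A * (1 / 2) ^ k) :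
    ∀ t ∈ Icc 0 T₁, HasSum (fun k => W k t (q t)) (v t) := by
  have h0mem : (0 : ℝ) ∈ Icc 0 T₁ := ⟨le_rfl, hT₁.1.le⟩
  have hsub : Icc 0 T₁ ⊆ Icc 0 T := Icc_subset_Icc_right hT₁.2
  have hA : 0 ≤ A := by simpa using (norm_nonneg _).trans (hWq 0 0 h0mem)
  have hC : 0 ≤ C := (norm_nonneg (G (q 0))).trans (hGq 0 h0mem)
  obtain ⟨M, hM⟩ : ∃ M, ∀ t ∈ Icc 0 T₁, ‖v t‖ ≤ M :=
    isCompact_Icc.exists_bound_of_continuousOn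
      (fun t ht => ((hv t (hsub ht)).continuousWithinAt.mono hsub : ContinuousWithinAt v _ t))
  have hM0 : 0 ≤ M := (norm_nonneg _).trans (hM 0 h0mem)
  have hgeom : ∀ N, ∑ k ∈ Finset.range N, A * (1 / 2 : ℝ) ^ k ≤ 2 * A := fun N => by
    rw [← Finset.mul_sum, mul_comm 2]
    gcongr
    exact (summable_geometric_two.sum_le_tsum _ fun _ _ => by positivity).trans_eq
      tsum_geometric_two
  set S : ℕ → ℝ → E := fun n t => ∑ k ∈ Finset.range (n + 1), W k t (q t) with hS
  set S' : ℕ → ℝ → E := fun n t => ∑ k ∈ Finset.range (n + 1),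
    (velocityRate G Y W k t (q t) + fderiv ℝ (W k t) (q t) (v t)) with hS'
  have hderiv : ∀ n, ∀ t ∈ Icc 0 T, HasDerivWithinAt (S n) (S' n t) (Icc 0 T) t := fun n t ht => by
    refine HasDerivWithinAt.fun_sum fun k _ => ?_
    have h := (isSeparated_velocityRate hG hY hW k).hasDerivWithinAt_integral_comp ht (hq t ht)
    rw [← funext (hrec k t ht)] at h
    exact h.congr_of_mem (fun τ hτ => hrec k τ hτ (q τ)) ht
  set B := A * A + C * A * A with hB
  set K := 2 * A + C * M + C * (2 * A) with hK
  have hineq : ∀ n, ∀ t ∈ Icc 0 T₁,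
      ‖Y t (q t) - G (q t) (v t) (v t) - S' n t‖
        ≤ K * ‖v t - S n t‖ + (n + 1 : ℝ) ^ 2 * (B * (1 / 2) ^ n) := fun n t ht => by
    set P : ℕ → ℕ → E := fun i j => covDeriv G (W i t) (W j t) (q t) with hP
    have hPle : ∀ i j, ‖P i j‖ ≤ B * (1 / 2) ^ (i + j) := fun i j => by
      calc ‖P i j‖ ≤ ‖fderiv ℝ (W i t) (q t)‖ * ‖W j t (q t)‖
            + ‖G (q t)‖ * ‖W i t (q t)‖ * ‖W j t (q t)‖ :=
            (norm_add_le _ _).trans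
              (add_le_add (ContinuousLinearMap.le_opNorm _ _)
                (ContinuousLinearMap.le_opNorm₂ _ _ _))
        _ ≤ (A * (1 / 2) ^ i) * (A * (1 / 2) ^ j)
            + C * (A * (1 / 2) ^ i) * (A * (1 / 2) ^ j) := by
            have := hWq i t ht
            have := hWq j t ht
            have := hDq i t ht
            have := hGq t ht
            gcongr
        _ = B * (1 / 2) ^ (i + j) := by rw [hB, pow_add]; ring
    have hrem := norm_sum_square_sub_sum_triangle_le hPle n
    set R := ∑ i ∈ Finset.range (n + 1), ∑ j ∈ Finset.range (n + 1), P i j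
      - ∑ k ∈ Finset.range n, ∑ ij ∈ Finset.HasAntidiagonal.antidiagonal k, P ij.1 ij.2 with hR
    set D : E →L[ℝ] E := ∑ k ∈ Finset.range (n + 1), fderiv ℝ (W k t) (q t) with hD
    have hsquare : ∑ i ∈ Finset.range (n + 1), ∑ j ∈ Finset.range (n + 1), P i j
        = D (S n t) + G (q t) (S n t) (S n t) := by
      simp only [hP, covDeriv, hD, hS, map_sum, sum_apply, Finset.sum_add_distrib]
      congr 1
      · exact Finset.sum_comm
      · exact Finset.sum_comm
    have hrate : ∑ k ∈ Finset.range (n + 1), velocityRate G Y W k t (q t)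
        = Y t (q t) - ∑ k ∈ Finset.range n,
          ∑ ij ∈ Finset.HasAntidiagonal.antidiagonal k, P ij.1 ij.2 := by
      rw [Finset.sum_range_succ']
      simp only [velocityRate, Finset.sum_neg_distrib]
      abel
    have hid : Y t (q t) - G (q t) (v t) (v t) - S' n t
        = -(D (v t - S n t)) - G (q t) (v t) (v t - S n t)
          - G (q t) (v t - S n t) (S n t) - R := by
      have hDv : ∑ k ∈ Finset.range (n + 1), fderiv ℝ (W k t) (q t) (v t) = D (v t) := by
        simp [hD]
      rw [hR, hsquare]
      simp only [hS', Finset.sum_add_distrib, hrate, hDv, map_sub, sub_apply]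
      abel
    have hSle : ‖S n t‖ ≤ 2 * A :=
      (norm_sum_le_of_le _ fun k _ => hWq k t ht).trans (hgeom _)
    have hDle : ‖D‖ ≤ 2 * A :=
      (norm_sum_le_of_le _ fun k _ => hDq k t ht).trans (hgeom _)
    rw [hid]
    calc _ ≤ ‖D‖ * ‖v t - S n t‖ + ‖G (q t)‖ * ‖v t‖ * ‖v t - S n t‖
          + ‖G (q t)‖ * ‖v t - S n t‖ * ‖S n t‖ + ‖R‖ := by
          refine (norm_sub_le _ _).trans (add_le_add ?_ le_rfl)
          refine (norm_sub_le _ _).trans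
            (add_le_add ?_ (ContinuousLinearMap.le_opNorm₂ _ _ _))
          refine (norm_sub_le _ _).trans
            (add_le_add ?_ (ContinuousLinearMap.le_opNorm₂ _ _ _))
          rw [norm_neg]
          exact ContinuousLinearMap.le_opNorm _ _
      _ ≤ 2 * A * ‖v t - S n t‖ + C * M * ‖v t - S n t‖
          + C * ‖v t - S n t‖ * (2 * A) + (n + 1 : ℝ) ^ 2 * (B * (1 / 2) ^ n) := by
          have := hGq t ht
          have := hM t ht
          gcongr
      _ = _ := by rw [hK]; ring
  have hgron : ∀ n, ∀ t ∈ Icc 0 T₁,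
      ‖v t - S n t‖ ≤ gronwallBound 0 K ((n + 1 : ℝ) ^ 2 * (B * (1 / 2) ^ n)) (t - 0) := fun n => by
    have hsubd : ∀ t ∈ Icc 0 T, HasDerivWithinAt (fun t => v t - S n t)
        (Y t (q t) - G (q t) (v t) (v t) - S' n t) (Icc 0 T) t := fun t ht =>
      (hv t ht).fun_sub (hderiv n t ht)
    refine norm_le_gronwallBound_of_norm_deriv_right_le
      (fun t ht => (hsubd t (hsub ht)).continuousWithinAt.mono hsub) (fun t ht => ?_) ?_
      fun t ht => hineq n t (Ico_subset_Icc_self ht)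
    · exact (hsubd t (hsub (Ico_subset_Icc_self ht))).mono_of_mem_nhdsWithin
        (mem_of_superset (Icc_mem_nhdsGE (ht.2.trans_le hT₁.2)) (Icc_subset_Icc_left ht.1))
    · simp [hv0, hS, hrec _ 0 (hsub h0mem)]
  have hrem0 : Tendsto (fun n : ℕ => (n + 1 : ℝ) ^ 2 * (B * (1 / 2) ^ n)) atTop (𝓝 0) := by
    have h := ((tendsto_add_atTop_iff_nat 1).2
      (tendsto_pow_const_mul_const_pow_of_lt_one 2 (r := (1 / 2 : ℝ)) (by norm_num)
        (by norm_num))).const_mul (2 * B)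
    rw [mul_zero] at h
    refine h.congr fun n => ?_
    push_cast
    ring
  intro t ht
  have hsum : Summable fun k => W k t (q t) :=
    Summable.of_norm_bounded (summable_geometric_two.mul_left A) fun k => hWq k t ht
  refine (hsum.hasSum_iff_tendsto_nat).2 ((tendsto_add_atTop_iff_nat 1).1 ?_)
  refine tendsto_iff_norm_sub_tendsto_zero.2 ?_
  have hbound : Tendsto (fun n : ℕ => gronwallBound 0 K ((n + 1 : ℝ) ^ 2 * (B * (1 / 2) ^ n))
      (t - 0)) atTop (𝓝 0) := by
    have h := ((gronwallBound_continuous_ε 0 K (t - 0)).tendsto 0).comp hrem0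
    rwa [gronwallBound_ε0_δ0] at h
  refine squeeze_zero (fun _ => norm_nonneg _) (fun n => ?_) hbound
  rw [norm_sub_rev]
  exact hgron n t ht

end Velocity

section SymmetricProduct

variable {E : Type*} [NormedAddCommGroup E] [NormedSpace ℝ E]
  {G : E → E →L[ℝ] E →L[ℝ] E} {Y : ℝ → E → E} {W : ℕ → ℝ → E → E} {T : ℝ}

theorem isSeparated_of_symmetric_recursion [CompleteSpace E] (hG : ContDiff ℝ ∞ G)
    (hY : IsSeparated T Y)
    (hW0 : ∀ t x, W 0 t x = ∫ s in (0 : ℝ)..t, Y s x)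
    (hWs : ∀ k t x, W (k + 1) t x = -(1 / 2 : ℝ) •
      ∑ ij ∈ Finset.HasAntidiagonal.antidiagonal k, ∫ s in (0 : ℝ)..t,
        (covDeriv G (W ij.1 s) (W ij.2 s) x + covDeriv G (W ij.2 s) (W ij.1 s) x)) (k : ℕ) :
    IsSeparated T (W k) := by
  induction k using Nat.strong_induction_on with
  | _ k ih =>
    cases k with
    | zero => exact hY.integral.congr fun t _ x => hW0 t x
    | succ k =>
      refine IsSeparated.congr (IsSeparated.const_smul (IsSeparated.sum _ fun ij hij => ?_) _)
        fun t _ x => hWs k t x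
      have hk := Finset.HasAntidiagonal.mem_antidiagonal.1 hij
      have h1 := ih ij.1 (by omega)
      have h2 := ih ij.2 (by omega)
      exact ((h1.covDeriv h2 hG).add (h2.covDeriv h1 hG)).integral

theorem eq_integral_velocityRate_of_symmetric_recursion (hG : ContDiff ℝ ∞ G)
    (hW : ∀ k, IsSeparated T (W k))
    (hW0 : ∀ t x, W 0 t x = ∫ s in (0 : ℝ)..t, Y s x)
    (hWs : ∀ k t x, W (k + 1) t x = -(1 / 2 : ℝ) •
      ∑ ij ∈ Finset.HasAntidiagonal.antidiagonal k, ∫ s in (0 : ℝ)..t,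
        (covDeriv G (W ij.1 s) (W ij.2 s) x + covDeriv G (W ij.2 s) (W ij.1 s) x))
    (k : ℕ) {t : ℝ} (ht : t ∈ Icc 0 T) (x : E) :
    W k t x = ∫ s in (0 : ℝ)..t, velocityRate G Y W k s x := by
  cases k with
  | zero => exact hW0 t x
  | succ k =>
    have hint : ∀ i j : ℕ, IntervalIntegrable (fun s => covDeriv G (W i s) (W j s) x)
        MeasureTheory.volume 0 t := fun i j =>
      ((hW i).covDeriv (hW j) hG).intervalIntegrable ht x
    have hswap : ∑ ij ∈ Finset.HasAntidiagonal.antidiagonal k,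
        (∫ s in (0 : ℝ)..t, covDeriv G (W ij.2 s) (W ij.1 s) x)
        = ∑ ij ∈ Finset.HasAntidiagonal.antidiagonal k,
          ∫ s in (0 : ℝ)..t, covDeriv G (W ij.1 s) (W ij.2 s) x :=
      Finset.Nat.sum_antidiagonal_swap (n := k)
        (f := fun ij : ℕ × ℕ => ∫ s in (0 : ℝ)..t, covDeriv G (W ij.1 s) (W ij.2 s) x)
    rw [hWs k t x]
    simp only [velocityRate]
    rw [intervalIntegral.integral_neg, intervalIntegral.integral_finsetSum fun ij _ => hint _ _,
      Finset.sum_congr rfl fun ij _ => intervalIntegral.integral_add (hint ij.1 ij.2)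
        (hint ij.2 ij.1), Finset.sum_add_distrib, hswap, ← two_smul ℝ, smul_smul]
    simp

end SymmetricProduct

theorem AnalyticAt.smul_const {E F : Type*} [NormedAddCommGroup E] [NormedSpace ℝ E]
    [NormedAddCommGroup F] [NormedSpace ℝ F] {f : E → ℝ} {x : E} (hf : AnalyticAt ℝ f x) (c : F) :
    AnalyticAt ℝ (fun y => f y • c) x :=
  hf.smul analyticAt_const

section Christoffel

variable {n : ℕ} {Γ : (Fin n → ℝ) → Fin n → Fin n → Fin n → ℝ}

/-- The bilinear form `(v, w) ↦ christoffelOp n Γ q v w`. -/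
def christoffelForm (n : ℕ) (Γ : (Fin n → ℝ) → Fin n → Fin n → Fin n → ℝ) (q : Fin n → ℝ) :
    (Fin n → ℝ) →L[ℝ] (Fin n → ℝ) →L[ℝ] (Fin n → ℝ) :=
  ∑ i, ∑ j, ∑ k, Γ q i j k •
    (ContinuousLinearMap.proj (R := ℝ) (φ := fun _ : Fin n => ℝ) j).smulRight
    ((ContinuousLinearMap.proj (R := ℝ) (φ := fun _ : Fin n => ℝ) k).smulRight
      (Pi.single i 1 : Fin n → ℝ))

theorem christoffelForm_apply (q v w : Fin n → ℝ) :
    christoffelForm n Γ q v w = christoffelOp n Γ q v w := by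
  ext i
  simp [christoffelForm, christoffelOp, Finset.sum_apply, Pi.single_apply, mul_assoc]

theorem analyticOnNhd_christoffelForm
    (hΓ : ∀ i j k : Fin n, AnalyticOnNhd ℝ (fun q => Γ q i j k) univ) :
    AnalyticOnNhd ℝ (christoffelForm n Γ) univ := fun q _ => by
  refine Finset.analyticAt_fun_sum _ fun i _ => Finset.analyticAt_fun_sum _ fun j _ =>
    Finset.analyticAt_fun_sum _ fun k _ => ?_
  exact (hΓ i j k q trivial).smul_const _

theorem symProd_eq_covDeriv_add (X Z : (Fin n → ℝ) → Fin n → ℝ) (x : Fin n → ℝ) :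
    symProd n Γ X Z x
      = covDeriv (christoffelForm n Γ) X Z x + covDeriv (christoffelForm n Γ) Z X x := by
  simp only [symProd, covDeriv, christoffelForm_apply]
  abel

end Christoffel

/-- Finitely many analytic maps have majorants with a common rate near a point. -/
theorem exists_common_hasMajorant {ι E F₁ F₂ : Type*} [Fintype ι]
    [NormedAddCommGroup E] [NormedSpace ℝ E]
    [NormedAddCommGroup F₁] [NormedSpace ℝ F₁] [CompleteSpace F₁]
    [NormedAddCommGroup F₂] [NormedSpace ℝ F₂] [CompleteSpace F₂]
    {G : E → F₁} (hG : AnalyticOnNhd ℝ G univ) {Y : ι → E → F₂}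
    (hY : ∀ a, AnalyticOnNhd ℝ (Y a) univ) {T : ℝ} {u : ι → ℝ → ℝ}
    (hu : ∀ a, ContinuousOn (u a) (Icc 0 T)) (x₀ : E) :
    ∃ L C c, 0 ≤ L ∧ 0 ≤ C ∧ 0 ≤ c ∧ ∀ᶠ x in 𝓝 x₀, HasMajorant G x L C 1 ∧
      ∀ t ∈ Icc 0 T, HasMajorant (fun x => ∑ a, u a t • Y a x) x L c 1 := by
  have hYs : ∀ a, ContDiff ℝ ∞ (Y a) := fun a => (hY a).contDiff
  obtain ⟨C, L, hL, hGm⟩ := (hG x₀ trivial).exists_hasMajorant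
  choose c K hK hYm using fun a => (hY a x₀ trivial).exists_hasMajorant
  choose M hM using fun a => isCompact_Icc.exists_bound_of_continuousOn (hu a)
  have hC : 0 ≤ C := hGm.self_of_nhds.nonneg
  have hc : ∀ a, 0 ≤ c a := fun a => (hYm a).self_of_nhds.nonneg
  have hK' : 0 ≤ ∑ a, K a := Finset.sum_nonneg fun a _ => hK a
  have hLK : 0 ≤ L + ∑ a, K a := add_nonneg hL hK'
  refine ⟨L + ∑ a, K a, C, ∑ a, |M a| * c a, hLK, hC,
    Finset.sum_nonneg fun a _ => mul_nonneg (abs_nonneg _) (hc a), ?_⟩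
  filter_upwards [hGm, eventually_all.2 hYm] with x hGx hYx
  refine ⟨hGx.mono_rate hL (le_add_of_nonneg_right hK'), fun t ht => ?_⟩
  refine HasMajorant.sum _ (fun a _ => ?_) fun a _ => contDiff_const.smul (hYs a)
  refine (((hYx a).mono_rate (hK a) ?_).const_smul (hYs a) (u a t)).mono hLK ?_
  · exact (Finset.single_le_sum (fun b _ => hK b) (Finset.mem_univ a)).trans
      (le_add_of_nonneg_left hL)
  · exact mul_le_mul_of_nonneg_right ((hM a t ht).trans (le_abs_self _)) (hc a)

/-- series expansion for the forced evolution starting from rest.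
For real-analytic data, the velocity of the solution of
`q̈ + Γ(q)(q̇, q̇) = Σ_a Y_a(q) u_a(t)`, `q̇(0) = 0`, is given by the series
`q̇(t) = Σ_{k≥1} V_k(q(t), t)`, where the `V_k` are defined recursively from
the inputs via the symmetric product; the series converges absolutely and
uniformly on a neighborhood of `q_0` and a time interval `[0, T']`. -/
theorem series_expansion_from_rest (n m : ℕ)
    (Γ : (Fin n → ℝ) → Fin n → Fin n → Fin n → ℝ)
    (hΓ : ∀ i j k : Fin n, AnalyticOnNhd ℝ (fun q => Γ q i j k) Set.univ)
    (Y : Fin m → (Fin n → ℝ) → (Fin n → ℝ))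
    (hY : ∀ a, AnalyticOnNhd ℝ (Y a) Set.univ)
    (T : ℝ) (hT : 0 < T)
    (u : Fin m → ℝ → ℝ) (hu : ∀ a, ContinuousOn (u a) (Set.Icc 0 T))
    -- the recursively defined vector fields `V_k`
    (V : ℕ → (Fin n → ℝ) → ℝ → (Fin n → ℝ))
    (hV1 : ∀ q t, V 1 q t = ∫ s in (0:ℝ)..t, ∑ a, u a s • Y a q)
    (hVk : ∀ k, 2 ≤ k → ∀ q t,
      V k q t = -(1/2 : ℝ) • ∑ j ∈ Finset.Ico 1 k,
        ∫ s in (0:ℝ)..t,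
          symProd n Γ (fun q' => V j q' s) (fun q' => V (k - j) q' s) q)
    -- a C² solution starting from rest
    (q0 : Fin n → ℝ) (q : ℝ → (Fin n → ℝ))
    (hq : ContDiffOn ℝ 2 q (Set.Icc 0 T))
    (hq0 : q 0 = q0)
    (hv0 : derivWithin q (Set.Icc 0 T) 0 = 0)
    (hode : ∀ t ∈ Set.Icc (0:ℝ) T,
      derivWithin (derivWithin q (Set.Icc 0 T)) (Set.Icc 0 T) t
        + christoffelOp n Γ (q t) (derivWithin q (Set.Icc 0 T) t)
            (derivWithin q (Set.Icc 0 T) t)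
        = ∑ a, u a t • Y a (q t)) :
    ∃ T' ∈ Set.Ioc 0 T, ∃ U ∈ nhds q0,
      -- absolute and uniform convergence on U × [0, T'] (Weierstrass bound)
      (∃ M : ℕ → ℝ, Summable M ∧
        ∀ k, 1 ≤ k → ∀ q' ∈ U, ∀ t ∈ Set.Icc (0:ℝ) T', ‖V k q' t‖ ≤ M k) ∧
      -- the velocity is the sum of the series
      (∀ t ∈ Set.Icc (0:ℝ) T',
        HasSum (fun k : ℕ => V (k + 1) (q t) t)
          (derivWithin q (Set.Icc 0 T) t)) := by
  set G := christoffelForm n Γ with hGdef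
  set W : ℕ → ℝ → (Fin n → ℝ) → Fin n → ℝ := fun k t x => V (k + 1) x t with hWdef
  set Y₀ : ℝ → (Fin n → ℝ) → Fin n → ℝ := fun t x => ∑ a, u a t • Y a x
  have hGa : AnalyticOnNhd ℝ G univ := analyticOnNhd_christoffelForm hΓ
  have hGs : ContDiff ℝ ∞ G := hGa.contDiff
  have hYs : ∀ a, ContDiff ℝ ∞ (Y a) := fun a => (hY a).contDiff
  have hY₀ : IsSeparated T Y₀ :=
    IsSeparated.sum _ fun a _ => IsSeparated.smul_of_continuousOn hT.le (hu a) (hYs a)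
  have hW0 : ∀ t x, W 0 t x = ∫ s in (0 : ℝ)..t, Y₀ s x := fun t x => hV1 x t
  have hWs : ∀ k t x, W (k + 1) t x = -(1 / 2 : ℝ) •
      ∑ ij ∈ Finset.HasAntidiagonal.antidiagonal k, ∫ s in (0 : ℝ)..t,
        (covDeriv G (W ij.1 s) (W ij.2 s) x + covDeriv G (W ij.2 s) (W ij.1 s) x) := by
    intro k t x
    simp only [hWdef]
    rw [hVk (k + 1 + 1) (by omega) x t, Finset.sum_Ico_eq_sum_range,
      Finset.Nat.sum_antidiagonal_eq_sum_range_succ_mk]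
    refine congrArg _ (Finset.sum_congr (by simp) fun j hj => ?_)
    have hj : j ≤ k := by simpa [Nat.lt_succ_iff] using hj
    have h1 : k + 1 + 1 - (j + 1) = k - j + 1 := by omega
    simp only [add_comm 1 j, h1, symProd_eq_covDeriv_add, hGdef]
  have hW : ∀ k, IsSeparated T (W k) := isSeparated_of_symmetric_recursion hGs hY₀ hW0 hWs
  have hrec : ∀ k, ∀ t ∈ Icc 0 T, ∀ x, W k t x = ∫ s in (0 : ℝ)..t, velocityRate G Y₀ W k s x :=
    fun k t ht x => eq_integral_velocityRate_of_symmetric_recursion hGs hW hW0 hWs k ht x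
  obtain ⟨L, C, c, hL, hC, hc, hU⟩ := exists_common_hasMajorant hGa hY hu q0
  obtain ⟨T₁, hT₁, A, hA, hbound⟩ :=
    exists_time_geometric_bound hT hGs hY₀ hW hrec hL hC hc
  have hqd : ∀ t ∈ Icc 0 T, HasDerivWithinAt q (derivWithin q (Icc 0 T) t) (Icc 0 T) t :=
    fun t ht => (hq.differentiableOn (by norm_num) t ht).hasDerivWithinAt
  have hvd : ∀ t ∈ Icc 0 T, HasDerivWithinAt (derivWithin q (Icc 0 T))
      (Y₀ t (q t) - G (q t) (derivWithin q (Icc 0 T) t) (derivWithin q (Icc 0 T) t))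
      (Icc 0 T) t := fun t ht => by
    have h1 : ContDiffOn ℝ 1 (derivWithin q (Icc 0 T)) (Icc 0 T) :=
      hq.derivWithin (uniqueDiffOn_Icc hT) (by norm_num)
    refine ((h1.differentiableOn (by norm_num) t ht).hasDerivWithinAt).congr_deriv ?_
    rw [eq_sub_iff_add_eq, hGdef, christoffelForm_apply]
    exact hode t ht
  have hqU : ∀ᶠ t in 𝓝[≥] (0 : ℝ), q t ∈ {x | HasMajorant G x L C 1 ∧
      ∀ t ∈ Icc 0 T, HasMajorant (Y₀ t) x L c 1} := by
    have h0 := hq.continuousOn 0 ⟨le_rfl, hT.le⟩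
    rw [ContinuousWithinAt, nhdsWithin_Icc_eq_nhdsGE hT, hq0] at h0
    exact h0 hU
  obtain ⟨ε, hε, hεU⟩ := mem_nhdsGE_iff_exists_Icc_subset.1 hqU
  have hT' : min T₁ ε ∈ Ioc 0 T := ⟨lt_min hT₁.1 hε, (min_le_left _ _).trans hT₁.2⟩
  have hsub₁ : Icc 0 (min T₁ ε) ⊆ Icc 0 T₁ := Icc_subset_Icc_right (min_le_left _ _)
  have hqmem : ∀ t ∈ Icc 0 (min T₁ ε), HasMajorant G (q t) L C 1 ∧
      ∀ t' ∈ Icc 0 T, HasMajorant (Y₀ t') (q t) L c 1 := fun t ht =>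
    hεU (Icc_subset_Icc_right (min_le_right _ _) ht)
  refine ⟨min T₁ ε, hT', _, hU, ⟨fun k => A * (1 / 2) ^ (k - 1), ?_, ?_⟩, ?_⟩
  · rw [← summable_nat_add_iff 1]
    exact summable_geometric_two.mul_left A
  · intro k hk x hx t ht
    have h := (hbound x hx.1 hx.2 (k - 1) t (hsub₁ ht)).1
    simpa only [hWdef, Nat.sub_add_cancel hk] using h
  · exact hasSum_velocity hGs hY₀ hW hrec hqd hvd hv0 hT'
      (fun t ht => (hqmem t ht).1.norm_le)
      (fun k t ht => (hbound _ (hqmem t ht).1 (hqmem t ht).2 k t (hsub₁ ht)).1)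
      (fun k t ht => (hbound _ (hqmem t ht).1 (hqmem t ht).2 k t (hsub₁ ht)).2)

end
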